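/- Define ũ^Ext(0; p₀, p₁) := if p₀ > p₁ then 1 else 0 and ũ^Ext(1; p₀, p₁) := if p₀ < p₁ then 1/2 else 0, for (p₀, p₁) ∈ ℝ². For a lottery P on {0,1} × {0,1}, let m(P) := (E_P[y₀], E_P[y₁]) be its pair of coordinate means, and define the relation P ≿ Q iff ũ^Ext(1; m(P)) ≥ ũ^Ext(1; m(Q)) on lotteries paired with the fixed decision d = 1. Let P be the Dirac lottery at (0, 1) and Q the Dirac lottery at (1, 0). Then: ũ^Ext(1; m(P)) = 1/2 > 0 = ũ^Ext(1; m(Q)), so P ≻ Q; the mixture L := 0.4·P + 0.6·Q has m(L) = (0.6, 0.4) and ũ^Ext(1; m(L)) = 0 = ũ^Ext(1; m(Q)), so L ∼ Q even though L = 0.4·P + 0.6·Q and Q = 0.4·Q + 0.6·Q. Hence the relation ≿ induced by the extended counterfactual utility violates the vNM Independence axiom (with r = Q and α = 0.4). -/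

import Mathlib

/-- `p` is a lottery on the finite type `Z`. -/
def IsLottery {Z : Type*} [Fintype Z] (p : Z → ℝ) : Prop :=
  (∀ z, 0 ≤ p z) ∧ ∑ z, p z = 1

/-- Mixture `α p + (1 - α) q`. -/
def mix {Z : Type*} (α : ℝ) (p q : Z → ℝ) : Z → ℝ :=
  fun z => α * p z + (1 - α) * q z

/-- Strict preference `p ≻ q`. -/
def StrictPref {Z : Type*} (R : (Z → ℝ) → (Z → ℝ) → Prop) (p q : Z → ℝ) : Prop :=
  R p q ∧ ¬ R q p

/-- vNM Independence on lotteries. -/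
def IndependenceAx {Z : Type*} [Fintype Z] (R : (Z → ℝ) → (Z → ℝ) → Prop) : Prop :=
  ∀ p q r : Z → ℝ, IsLottery p → IsLottery q → IsLottery r →
    ∀ α : ℝ, 0 < α → α ≤ 1 →
      StrictPref R p q → StrictPref R (mix α p r) (mix α q r)

/-- Lotteries over the pair of binary potential outcomes `(y₀, y₁)`. -/
abbrev Z15 := Fin 2 × Fin 2

/-- Gelman–Meng's extended counterfactual utility:
`ũ^Ext(0; p₀, p₁) = 1{p₀ > p₁}` and `ũ^Ext(1; p₀, p₁) = (1/2)·1{p₀ < p₁}`. -/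
noncomputable def uExt15 : Fin 2 → ℝ × ℝ → ℝ := fun d p =>
  if d = 0 then (if p.2 < p.1 then 1 else 0) else (if p.1 < p.2 then 1/2 else 0)

/-- The pair of coordinate means `m(P) = (E_P[y₀], E_P[y₁])`. -/
noncomputable def m15 (P : Z15 → ℝ) : ℝ × ℝ :=
  (∑ z, ((z.1 : ℕ) : ℝ) * P z, ∑ z, ((z.2 : ℕ) : ℝ) * P z)

/-- The relation induced by the extended utility and the fixed decision `d = 1`:
`P ≿ Q ↔ ũ^Ext(1; m(P)) ≥ ũ^Ext(1; m(Q))`. -/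
noncomputable def R15 : (Z15 → ℝ) → (Z15 → ℝ) → Prop :=
  fun P Q => uExt15 1 (m15 P) ≥ uExt15 1 (m15 Q)

/-- Dirac lottery at `(0, 1)`. -/
noncomputable def P15 : Z15 → ℝ := fun z => if z = (0, 1) then 1 else 0

/-- Dirac lottery at `(1, 0)`. -/
noncomputable def Q15 : Z15 → ℝ := fun z => if z = (1, 0) then 1 else 0

/-- The mixture `L = 0.4·P + 0.6·Q`. -/
noncomputable def L15 : Z15 → ℝ := mix 0.4 P15 Q15

theorem m15_P15 : m15 P15 = (0, 1) := by
  simp [m15, P15]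

theorem m15_Q15 : m15 Q15 = (1, 0) := by
  simp [m15, Q15]

theorem m15_mix (α : ℝ) (p q : Z15 → ℝ) :
    m15 (mix α p q) = α • m15 p + (1 - α) • m15 q := by
  ext <;> simp only [m15, mix, Prod.fst_add, Prod.snd_add, Prod.smul_fst, Prod.smul_snd,
    smul_eq_mul, Finset.mul_sum, ← Finset.sum_add_distrib] <;>
    exact Finset.sum_congr rfl fun z _ => by ring

theorem mix_self {Z : Type*} (α : ℝ) (p : Z → ℝ) : mix α p p = p := by
  ext z
  simp only [mix]
  ring

theorem isLottery_P15 : IsLottery P15 :=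
  ⟨fun z => by unfold P15; split_ifs <;> norm_num, by simp [P15]⟩

theorem isLottery_Q15 : IsLottery Q15 :=
  ⟨fun z => by unfold Q15; split_ifs <;> norm_num, by simp [Q15]⟩

/-- Under the extended counterfactual utility evaluated at marginal means,
`ũ^Ext(1; m(P)) = 1/2 > 0 = ũ^Ext(1; m(Q))` so `P ≻ Q`; yet the mixture
`L = 0.4·P + 0.6·Q` has `m(L) = (0.6, 0.4)` with `ũ^Ext(1; m(L)) = 0`, so `L ∼ Q` even
though `Q = 0.4·Q + 0.6·Q`. Hence the induced relation violates the vNM Independence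
axiom (with `r = Q` and `α = 0.4`). -/
theorem extended_utility_violates_independence :
    uExt15 1 (m15 P15) = 1/2 ∧ uExt15 1 (m15 Q15) = 0 ∧
    StrictPref R15 P15 Q15 ∧
    m15 L15 = (0.6, 0.4) ∧ uExt15 1 (m15 L15) = 0 ∧
    (R15 L15 Q15 ∧ R15 Q15 L15) ∧
    ¬ IndependenceAx R15 := by
  have hP : uExt15 1 (m15 P15) = 1/2 := by simp [m15_P15, uExt15]
  have hQ : uExt15 1 (m15 Q15) = 0 := by simp [m15_Q15, uExt15]
  have hm : m15 L15 = (0.6, 0.4) := by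
    rw [L15, m15_mix, m15_P15, m15_Q15]
    ext <;> norm_num
  have hL : uExt15 1 (m15 L15) = 0 := by
    rw [hm]
    norm_num [uExt15]
  have hPQ : StrictPref R15 P15 Q15 := by
    simp only [StrictPref, R15, hP, hQ]
    norm_num
  have hLQ : R15 L15 Q15 ∧ R15 Q15 L15 := by
    simp only [R15, hL, hQ]
    norm_num
  refine ⟨hP, hQ, hPQ, hm, hL, hLQ, fun h => ?_⟩
  have hstrict := h P15 Q15 Q15 isLottery_P15 isLottery_Q15 isLottery_Q15 0.4
    (by norm_num) (by norm_num) hPQ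
  rw [mix_self] at hstrict
  exact hstrict.2 hLQ.2
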